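/- Let Γ be a finite simple graph on {1,…,n}, K its clique complex, and f : [n] → [m] a surjective function. Let ℤ[ℤ^m] = ℤ[y_1^{±1},…,y_m^{±1}] be the group ring of ℤ^m, made into a G_Γ-module by letting v_i act as multiplication by y_{f(i)}. Consider the cochain complex C^• of free ℤ[ℤ^m]-modules whose p-th term has basis {ε_I : I ∈ K, |I| = p} indexed by the faces of K of cardinality p, with differential δ(ε_I) = Σ_{i ∉ I, I∪{i} ∈ K} (−1)^{σ(I,i)} (y_{f(i)} − 1) ε_{I∪{i}}, where σ(I,i) is the number of elements of I preceding i. Then for every q ≥ 0 the group cohomology H^q(G_Γ; ℤ[ℤ^m]) is isomorphic to the q-th cohomology of C^•. -/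

import Mathlib

attribute [local instance] Classical.propDecidable

noncomputable section

/-! ### Right-angled Artin groups -/

/-- The defining relators of a right-angled Artin group. -/
def raagRels {n : ℕ} (G : SimpleGraph (Fin n)) : Set (FreeGroup (Fin n)) :=
  {r | ∃ i j : Fin n, G.Adj i j ∧
    r = FreeGroup.of i * FreeGroup.of j * (FreeGroup.of i)⁻¹ * (FreeGroup.of j)⁻¹}

/-- The right-angled Artin group of a finite simple graph on `Fin n`. -/
abbrev RAAG {n : ℕ} (G : SimpleGraph (Fin n)) : Type :=
  PresentedGroup (raagRels G)

/-- The clique complex of a graph: faces are the finite sets of pairwise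
adjacent vertices. -/
def cliqueComplex {n : ℕ} (Γ : SimpleGraph (Fin n)) : Set (Finset (Fin n)) :=
  {σ | ∀ i ∈ σ, ∀ j ∈ σ, i ≠ j → Γ.Adj i j}

/-! ### The group ring `A[ℤᵐ]` and group cohomology via inhomogeneous cochains -/

/-- The group ring `A[ℤᵐ]`, a commutative ring of Laurent polynomials. -/
abbrev LaurentRing (A : Type) [CommRing A] (m : ℕ) : Type :=
  AddMonoidAlgebra A (Fin m → ℤ)

/-- Multiplication by the monomial `y^v` on the Laurent ring. -/
def yMul (A : Type) [CommRing A] (m : ℕ) (v : Fin m → ℤ) :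
    LaurentRing A m →ₗ[LaurentRing A m] LaurentRing A m :=
  LinearMap.mulLeft (LaurentRing A m) (AddMonoidAlgebra.single v 1)

/-- The space of inhomogeneous `q`-cochains of `G` with values in `A[ℤᵐ]`. -/
abbrev inhomogCochains (A : Type) [CommRing A] (m : ℕ) (G : Type) (q : ℕ) : Type :=
  (Fin q → G) → LaurentRing A m

variable (A : Type) [CommRing A] {m : ℕ} {G : Type} [Group G]
  (φ : G →* Multiplicative (Fin m → ℤ))

/-- The differential of the inhomogeneous cochain complex computing group
cohomology, where `g ∈ G` acts on `A[ℤᵐ]` by multiplication by `y^{φ g}`. -/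
def inhomogCoD (q : ℕ) :
    inhomogCochains A m G q →ₗ[LaurentRing A m] inhomogCochains A m G (q + 1) :=
  LinearMap.pi fun g : Fin (q + 1) → G =>
    (yMul A m (Multiplicative.toAdd (φ (g 0)))).comp
        (LinearMap.proj (fun i => g i.succ)) +
    ∑ j : Fin (q + 1),
      ((-1 : ℤ) ^ ((j : ℕ) + 1)) • LinearMap.proj (Fin.contractNth j (· * ·) g)

/-- The cochain differential entering degree `q` (zero for `q = 0`). -/
def inhomogCoDpre : ∀ q : ℕ,
    inhomogCochains A m G (q - 1) →ₗ[LaurentRing A m] inhomogCochains A m G q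
  | 0 => 0
  | (q + 1) => inhomogCoD A φ q

/-- The group cohomology `H^q(G; A[ℤᵐ])`, where `G` acts on the Laurent ring
through `φ`, computed from the inhomogeneous cochain complex. -/
def groupCohomologyLaurent (q : ℕ) : Type :=
  ↥(Submodule.map (LinearMap.range (inhomogCoDpre A φ q)).mkQ
      (LinearMap.ker (inhomogCoD A φ q)))

instance (q : ℕ) : AddCommGroup (groupCohomologyLaurent A φ q) :=
  inferInstanceAs (AddCommGroup ↥(Submodule.map _ _))

instance (q : ℕ) : Module (LaurentRing A m) (groupCohomologyLaurent A φ q) :=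
  inferInstanceAs (Module _ ↥(Submodule.map _ _))

/-! ### The cellular cochain complex of free `A[ℤᵐ]`-modules indexed by faces -/

variable {n : ℕ} (K : Set (Finset (Fin n))) (Λ : Type) [CommRing Λ] (coef : Fin n → Λ)

/-- The free `Λ`-module on the faces of `K` of cardinality `p`. -/
abbrev faceCochains (p : ℕ) : Type :=
  {I : Finset (Fin n) // I ∈ K ∧ I.card = p} → Λ

/-- The differential `δ ε_I = ∑_{i ∉ I, I ∪ {i} ∈ K} (-1)^{σ(I,i)} c_i ε_{I ∪ {i}}`
of the face cochain complex, with coefficients `c_i = coef i`. -/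
def faceCoD (p : ℕ) : faceCochains K Λ p →ₗ[Λ] faceCochains K Λ (p + 1) :=
  LinearMap.pi fun J => ∑ i : Fin n,
    if h : i ∈ J.1 ∧ J.1.erase i ∈ K then
      ((-1 : ℤ) ^ (J.1.filter (· < i)).card) •
        ((LinearMap.mulLeft Λ (coef i)).comp
          (LinearMap.proj
            (⟨J.1.erase i, h.2, by
                rw [Finset.card_erase_of_mem h.1, J.2.2, Nat.add_sub_cancel]⟩ :
              {I : Finset (Fin n) // I ∈ K ∧ I.card = p})))
    else 0

/-- The face cochain differential entering degree `p` (zero for `p = 0`). -/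
def faceCoDpre : ∀ p : ℕ, faceCochains K Λ (p - 1) →ₗ[Λ] faceCochains K Λ p
  | 0 => 0
  | (p + 1) => faceCoD K Λ coef p

/-- The `q`-th cohomology of the face cochain complex. -/
def faceCohomology (q : ℕ) : Type :=
  ↥(Submodule.map (LinearMap.range (faceCoDpre K Λ coef q)).mkQ
      (LinearMap.ker (faceCoD K Λ coef q)))

instance (q : ℕ) : AddCommGroup (faceCohomology K Λ coef q) :=
  inferInstanceAs (AddCommGroup ↥(Submodule.map _ _))

instance (q : ℕ) : Module Λ (faceCohomology K Λ coef q) :=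
  inferInstanceAs (Module _ ↥(Submodule.map _ _))

/-! ### Functions on a right-angled Artin group with prescribed increments -/

section CayleyGraph

variable {n : ℕ} {Γ : SimpleGraph (Fin n)}

/-- The `i`-th standard generator of a right-angled Artin group. -/
def raagGen (Γ : SimpleGraph (Fin n)) (i : Fin n) : RAAG Γ := PresentedGroup.of i

lemma raagGen_comm {i j : Fin n} (h : Γ.Adj i j) :
    raagGen Γ i * raagGen Γ j = raagGen Γ j * raagGen Γ i := by
  have h1 : (PresentedGroup.mk (raagRels Γ)) (FreeGroup.of i * FreeGroup.of j *
      (FreeGroup.of i)⁻¹ * (FreeGroup.of j)⁻¹) = 1 :=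
    PresentedGroup.one_of_mem ⟨i, j, h, rfl⟩
  simp only [map_mul, map_inv] at h1
  rw [mul_inv_eq_one, mul_inv_eq_iff_eq_mul] at h1
  exact h1

/-- A homomorphism out of a right-angled Artin group given on the generators. -/
lemma exists_raagHom {H : Type*} [Group H] (t : Fin n → H)
    (ht : ∀ i j, Γ.Adj i j → t i * t j = t j * t i) :
    ∃ ρ : RAAG Γ →* H, ∀ i, ρ (raagGen Γ i) = t i := by
  refine ⟨PresentedGroup.toGroup (f := t) ?_, fun i => PresentedGroup.toGroup.of _⟩
  rintro _ ⟨i, j, h, rfl⟩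
  simp [ht i j h]

/-- A `1`-cochain on the Cayley graph which is closed on all commutation squares is the
increment of a function. -/
lemma exists_raag_primitive {M : Type*} [AddCommGroup M] (F : Fin n → RAAG Γ → M)
    (hF : ∀ i j, Γ.Adj i j → ∀ g,
      F i g + F j (g * raagGen Γ i) = F j g + F i (g * raagGen Γ j)) :
    ∃ s : RAAG Γ → M, ∀ i g, s (g * raagGen Γ i) = s g + F i g := by
  let t : Fin n → Equiv.Perm (RAAG Γ × M) := fun i =>
    { toFun := fun p => (p.1 * raagGen Γ i, p.2 + F i p.1)
      invFun := fun p => (p.1 * (raagGen Γ i)⁻¹, p.2 - F i (p.1 * (raagGen Γ i)⁻¹))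
      left_inv := fun p => by simp
      right_inv := fun p => by simp }
  obtain ⟨ρ, hρ⟩ := exists_raagHom (Γ := Γ) (fun i => MulOpposite.op (t i)) (by
    intro i j h
    rw [← MulOpposite.op_mul, ← MulOpposite.op_mul]
    congr 1
    ext p : 1
    simp only [Equiv.Perm.mul_apply, t, Equiv.coe_fn_mk, Prod.mk.injEq, mul_assoc,
      raagGen_comm h, true_and, add_assoc]
    rw [hF i j h])
  have key : ∀ g p, ((ρ g).unop p).1 = p.1 * g := by
    intro g
    induction g using PresentedGroup.induction_on with | _ w => ?_
    induction w using FreeGroup.induction_on with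
    | C1 => simp
    | of i =>
      intro p
      change ((ρ (raagGen Γ i)).unop p).1 = p.1 * raagGen Γ i
      rw [hρ]; rfl
    | inv_of i _ =>
      intro p
      rw [map_inv, map_inv]
      change ((ρ (raagGen Γ i))⁻¹.unop p).1 = p.1 * (raagGen Γ i)⁻¹
      rw [hρ]; rfl
    | mul x y hx hy =>
      intro p
      rw [map_mul, map_mul, MulOpposite.unop_mul, Equiv.Perm.mul_apply, hy, hx, mul_assoc]
  refine ⟨fun g => ((ρ g).unop (1, 0)).2, fun i g => ?_⟩
  dsimp only
  rw [map_mul, MulOpposite.unop_mul, Equiv.Perm.mul_apply, hρ]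
  change _ + F i ((ρ g).unop (1, 0)).1 = _
  rw [key, one_mul]

end CayleyGraph

/-! ### Left ideals spanned by the elements `vᵢ - 1` -/

section LeftIdeals

open MonoidAlgebra

variable {n : ℕ} (Γ : SimpleGraph (Fin n)) (k : Type) [CommRing k]

/-- The element `vᵢ - 1` of the group algebra of a right-angled Artin group. -/
def raagU (i : Fin n) : MonoidAlgebra k (RAAG Γ) := single (raagGen Γ i) 1 - 1

/-- The left ideal spanned by the elements `vᵢ - 1` for `i ∈ S`. -/
def raagIdeal (S : Finset (Fin n)) : Ideal (MonoidAlgebra k (RAAG Γ)) :=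
  Ideal.span (raagU Γ k '' S)

variable {Γ k}

lemma raagU_comm {i j : Fin n} (h : Γ.Adj i j) :
    raagU Γ k i * raagU Γ k j = raagU Γ k j * raagU Γ k i := by
  have : (single (raagGen Γ i) 1 : MonoidAlgebra k (RAAG Γ)) * single (raagGen Γ j) 1 =
      single (raagGen Γ j) 1 * single (raagGen Γ i) 1 := by
    rw [single_mul_single, single_mul_single, raagGen_comm h]
  simp only [raagU, sub_mul, mul_sub, this, one_mul, mul_one]
  abel

lemma mem_raagIdeal_iff {S : Finset (Fin n)} {a : MonoidAlgebra k (RAAG Γ)} :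
    a ∈ raagIdeal Γ k S ↔ ∃ c : Fin n → MonoidAlgebra k (RAAG Γ),
      (∀ i ∉ S, c i = 0) ∧ ∑ i, c i * raagU Γ k i = a := by
  constructor
  · intro h
    obtain ⟨c, hc⟩ := (Submodule.mem_span_image_finset_iff_exists_fun _).1 h
    refine ⟨fun i => if h : i ∈ S then c ⟨i, h⟩ else 0, fun i hi => dif_neg hi, ?_⟩
    rw [← hc, ← Finset.sum_subset S.subset_univ (fun i _ hi => by simp [hi]),
      ← Finset.sum_coe_sort]
    exact Finset.sum_congr rfl fun i _ => by simp
  · rintro ⟨c, hc, rfl⟩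
    refine sum_mem fun i _ => ?_
    by_cases hi : i ∈ S
    · exact Ideal.mul_mem_left _ _ (Ideal.subset_span ⟨i, hi, rfl⟩)
    · simp [hc i hi]

/-- The vertex groups of the HNN decomposition along `v` meet properly: right multiplication by
`v - 1` is injective from `k[G/⟨L⟩]` to `k[G/⟨S⟩]`, where `L` is the link of `v` in `S`. -/
lemma mem_raagIdeal_link {S : Finset (Fin n)} {v : Fin n} (hv : v ∉ S)
    {a : MonoidAlgebra k (RAAG Γ)} (ha : a * raagU Γ k v ∈ raagIdeal Γ k S) :
    a ∈ raagIdeal Γ k (S.filter (Γ.Adj v)) := by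
  set L := S.filter (Γ.Adj v) with hL
  obtain ⟨ρ, hρ⟩ := exists_raagHom (Γ := Γ)
    (fun i => if i ∈ insert v S then raagGen Γ i else 1) (by
      intro i j h
      split_ifs <;> simp [raagGen_comm h])
  let q := Submodule.Quotient.mk (p := raagIdeal Γ k L)
  have hq : ∀ (g : RAAG Γ), ∀ i ∈ L, q (single (g * raagGen Γ i) 1) = q (single g 1) := by
    intro g i hi
    refine (Submodule.Quotient.eq _).2 ?_
    have : (single (g * raagGen Γ i) 1 - single g 1 : MonoidAlgebra k (RAAG Γ)) =
        single g 1 * raagU Γ k i := by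
      rw [raagU, mul_sub, single_mul_single, mul_one, mul_one]
    rw [this]
    exact Ideal.mul_mem_left _ _ (Ideal.subset_span ⟨i, hi, rfl⟩)
  obtain ⟨D, hD⟩ := exists_raag_primitive (Γ := Γ)
    (fun i g => if i = v then q (single (ρ g) 1) else 0) (by
      have main : ∀ i, Γ.Adj v i → ∀ g : RAAG Γ,
          q (single (ρ (g * raagGen Γ i)) 1) = q (single (ρ g) 1) := by
        intro i h g
        rw [map_mul, hρ]
        by_cases hi : i ∈ S
        · rw [if_pos (Finset.mem_insert_of_mem hi)]
          exact hq _ _ (Finset.mem_filter.2 ⟨hi, h⟩)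
        · rw [if_neg, mul_one]
          simp [hi, h.ne']
      intro i j h g
      by_cases hi : i = v
      · subst hi
        simp only [if_true, if_neg h.ne', main j h, add_zero, zero_add]
      · by_cases hj : j = v
        · subst hj
          simp only [if_true, if_neg hi, main i h.symm, add_zero, zero_add]
        · simp [hi, hj])
  let s : RAAG Γ → MonoidAlgebra k (RAAG Γ) ⧸ raagIdeal Γ k L := fun g =>
    (single (g * (ρ g)⁻¹) (1 : k) : MonoidAlgebra k (RAAG Γ)) • D g
  have hs1 : ∀ i ∈ S, ∀ g, s (g * raagGen Γ i) = s g := by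
    intro i hi g
    have hiv : i ≠ v := by rintro rfl; exact hv hi
    simp only [s]
    rw [hD, if_neg hiv, map_mul, hρ, if_pos (Finset.mem_insert_of_mem hi), add_zero]
    congr 2
    group
  have hs2 : ∀ g, s (g * raagGen Γ v) = s g + q (single g 1) := by
    intro g
    simp only [s]
    rw [hD, if_pos rfl, map_mul, hρ, if_pos (Finset.mem_insert_self _ _), smul_add]
    have : g * raagGen Γ v * (ρ g * raagGen Γ v)⁻¹ = g * (ρ g)⁻¹ := by group
    rw [this]
    congr 1
    rw [← Submodule.Quotient.mk_smul, smul_eq_mul, single_mul_single]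
    simp [q]
  let T : MonoidAlgebra k (RAAG Γ) →ₗ[k] (MonoidAlgebra k (RAAG Γ) ⧸ raagIdeal Γ k L) :=
    Finsupp.linearCombination k s ∘ₗ (coeffLinearEquiv k).toLinearMap
  have hT : ∀ g r, T (single g r) = r • s g := fun g r => by
    simp [T]
  have hT1 : ∀ x, ∀ i ∈ S, T (x * raagU Γ k i) = 0 := by
    intro x i hi
    induction x using MonoidAlgebra.induction_linear with
    | zero => simp
    | add f g hf hg => rw [add_mul, map_add, hf, hg, add_zero]
    | single g r =>
      rw [raagU, mul_sub, single_mul_single, mul_one, mul_one, map_sub, hT, hT, hs1 i hi, sub_self]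
  have hT2 : ∀ x, T (x * raagU Γ k v) = q x := by
    intro x
    induction x using MonoidAlgebra.induction_linear with
    | zero => simp [q]
    | add f g hf hg => rw [add_mul, map_add, hf, hg]; rfl
    | single g r =>
      rw [raagU, mul_sub, single_mul_single, mul_one, mul_one, map_sub, hT, hT, hs2, smul_add,
        add_sub_cancel_left]
      change r • Submodule.Quotient.mk _ = _
      rw [← Submodule.Quotient.mk_smul, smul_single', mul_one]
  obtain ⟨c, hc, hca⟩ := mem_raagIdeal_iff.1 ha
  refine (Submodule.Quotient.mk_eq_zero _).1 ((hT2 a).symm.trans ?_)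
  rw [← hca, map_sum]
  refine Finset.sum_eq_zero fun i _ => ?_
  by_cases hi : i ∈ S
  · exact hT1 _ i hi
  · simp [hc i hi]

end LeftIdeals

/-! ### Acyclicity of the complex of faces over the group algebra -/

section Acyclicity

open MonoidAlgebra

variable {n : ℕ} (Γ : SimpleGraph (Fin n)) (k : Type) [CommRing k]

/-- The differential `e_J ↦ ∑ ± (vᵢ - 1) e_{J \ i}` on all chains indexed by finite sets of
vertices, written in coordinates. -/
def raagD : (Finset (Fin n) → MonoidAlgebra k (RAAG Γ)) →ₗ[k]
    (Finset (Fin n) → MonoidAlgebra k (RAAG Γ)) where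
  toFun x J := ∑ i, if i ∈ J then 0 else
    ((-1 : ℤ) ^ (J.filter (· < i)).card) • (x (insert i J) * raagU Γ k i)
  map_add' x y := by
    funext J
    simp only [Pi.add_apply, ← Finset.sum_add_distrib]
    refine Finset.sum_congr rfl fun i _ => ?_
    split_ifs
    · simp
    · rw [add_mul, smul_add]
  map_smul' r x := by
    funext J
    simp only [Pi.smul_apply, RingHom.id_apply, Finset.smul_sum]
    refine Finset.sum_congr rfl fun i _ => ?_
    split_ifs
    · simp
    · rw [smul_mul_assoc, smul_comm]

variable {Γ k}

lemma raagD_apply (x : Finset (Fin n) → MonoidAlgebra k (RAAG Γ)) (J : Finset (Fin n)) :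
    raagD Γ k x J = ∑ i, if i ∈ J then 0 else
      ((-1 : ℤ) ^ (J.filter (· < i)).card) • (x (insert i J) * raagU Γ k i) := rfl

lemma raagD_apply_empty (x : Finset (Fin n) → MonoidAlgebra k (RAAG Γ)) :
    raagD Γ k x ∅ = ∑ i, x {i} * raagU Γ k i := by
  simp [raagD_apply]

/-- Chains supported on the faces contained in `S`. -/
def FaceSupported (S : Finset (Fin n)) (x : Finset (Fin n) → MonoidAlgebra k (RAAG Γ)) : Prop :=
  ∀ J, x J ≠ 0 → J ∈ cliqueComplex Γ ∧ J ⊆ S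

lemma cliqueComplex_mono {I J : Finset (Fin n)} (hIJ : I ⊆ J) (hJ : J ∈ cliqueComplex Γ) :
    I ∈ cliqueComplex Γ :=
  fun i hi j hj => hJ i (hIJ hi) j (hIJ hj)

lemma FaceSupported.raagD {S : Finset (Fin n)} {x : Finset (Fin n) → MonoidAlgebra k (RAAG Γ)}
    (hx : FaceSupported S x) : FaceSupported S (raagD Γ k x) := by
  intro J hJ
  obtain ⟨i, -, hi⟩ := Finset.exists_ne_zero_of_sum_ne_zero ((raagD_apply x J).symm.trans_ne hJ)
  have h : x (insert i J) ≠ 0 := by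
    intro h
    simp [h] at hi
  have := hx _ h
  exact ⟨cliqueComplex_mono (Finset.subset_insert _ _) this.1,
    (Finset.subset_insert _ _).trans this.2⟩

lemma FaceSupported.add {S : Finset (Fin n)} {x y : Finset (Fin n) → MonoidAlgebra k (RAAG Γ)}
    (hx : FaceSupported S x) (hy : FaceSupported S y) : FaceSupported S (x + y) := by
  intro J hJ
  by_cases h : x J = 0
  · exact hy J fun h' => hJ (by simp [h, h'])
  · exact hx J h

/-- Right multiplication by `vᵢ - 1` anticommutes with itself, so that the differential squares
to zero on chains supported on faces. -/
lemma raagD_raagD {S : Finset (Fin n)} {x : Finset (Fin n) → MonoidAlgebra k (RAAG Γ)}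
    (hx : FaceSupported S x) : raagD Γ k (raagD Γ k x) = 0 := by
  funext J
  let t : Fin n → Fin n → MonoidAlgebra k (RAAG Γ) := fun i j =>
    if i ∈ J ∨ j ∈ J ∨ i = j then 0 else
      ((-1 : ℤ) ^ ((J.filter (· < i)).card + ((insert i J).filter (· < j)).card)) •
        (x (insert j (insert i J)) * raagU Γ k j * raagU Γ k i)
  have h1 : raagD Γ k (raagD Γ k x) J = ∑ i, ∑ j, t i j := by
    rw [raagD_apply]
    refine Finset.sum_congr rfl fun i _ => ?_
    by_cases hi : i ∈ J
    · simp [hi, t]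
    · rw [if_neg hi, raagD_apply, Finset.sum_mul, Finset.smul_sum]
      refine Finset.sum_congr rfl fun j _ => ?_
      by_cases hj : j ∈ insert i J
      · have : i ∈ J ∨ j ∈ J ∨ i = j := by
          rcases Finset.mem_insert.1 hj with h | h
          · exact Or.inr (Or.inr h.symm)
          · exact Or.inr (Or.inl h)
        simp only [t]
        rw [if_pos hj, if_pos this, zero_mul, smul_zero]
      · have : ¬ (i ∈ J ∨ j ∈ J ∨ i = j) := by
          rw [Finset.mem_insert] at hj
          push Not at hj ⊢
          exact ⟨hi, hj.2, Ne.symm hj.1⟩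
        simp only [t]
        rw [if_neg hj, if_neg this, smul_mul_assoc, smul_smul, pow_add]
  have card_lt : ∀ i j : Fin n, i ∉ J → i < j →
      ((insert i J).filter (· < j)).card = (J.filter (· < j)).card + 1 := by
    intro i j hi hij
    rw [Finset.filter_insert, if_pos hij, Finset.card_insert_of_notMem]
    simp [hi]
  have card_gt : ∀ i j : Fin n, j < i →
      ((insert i J).filter (· < j)).card = (J.filter (· < j)).card := by
    intro i j hij
    rw [Finset.filter_insert, if_neg hij.not_gt]
  have anti : ∀ i j, i < j → t i j + t j i = 0 := by
    intro i j hij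
    by_cases h : i ∈ J ∨ j ∈ J ∨ i = j
    · have h' : j ∈ J ∨ i ∈ J ∨ j = i := by tauto
      simp only [t]
      rw [if_pos h, if_pos h', add_zero]
    · have h' : ¬ (j ∈ J ∨ i ∈ J ∨ j = i) := by tauto
      simp only [t]
      rw [if_neg h, if_neg h', Finset.insert_comm i j]
      by_cases hz : x (insert j (insert i J)) = 0
      · simp [hz]
      · have hadj : Γ.Adj i j := (hx _ hz).1 i (by simp) j (by simp) hij.ne
        rw [mul_assoc, mul_assoc, raagU_comm hadj, card_lt i j (fun hi => h (Or.inl hi)) hij,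
          card_gt j i hij, ← add_smul, ← add_assoc, pow_succ, add_comm (Finset.card _)]
        simp
  rw [h1, Pi.zero_apply]
  have h2 : ∀ i, t i i = 0 := fun i => if_pos (Or.inr (Or.inr rfl))
  rw [← Finset.sum_product']
  refine Finset.sum_involution (fun p _ => (p.2, p.1)) ?_ ?_ ?_ ?_
  · rintro ⟨i, j⟩ -
    rcases lt_trichotomy i j with h | rfl | h
    · exact anti i j h
    · simp [h2]
    · exact (add_comm _ _).trans (anti j i h)
  · rintro ⟨i, j⟩ - hne heq
    simp only [Prod.mk.injEq] at heq
    obtain ⟨rfl, -⟩ := heq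
    exact hne (h2 _)
  · simp
  · simp

/-- The chain `a ∧ v + b`. -/
def joinChain (v : Fin n) (a b : Finset (Fin n) → MonoidAlgebra k (RAAG Γ)) :
    Finset (Fin n) → MonoidAlgebra k (RAAG Γ) :=
  fun J => if v ∈ J then a (J.erase v) else b J

lemma joinChain_of_mem {v : Fin n} {a b : Finset (Fin n) → MonoidAlgebra k (RAAG Γ)}
    {J : Finset (Fin n)} (h : v ∈ J) : joinChain v a b J = a (J.erase v) := if_pos h

lemma joinChain_of_notMem {v : Fin n} {a b : Finset (Fin n) → MonoidAlgebra k (RAAG Γ)}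
    {J : Finset (Fin n)} (h : v ∉ J) : joinChain v a b J = b J := if_neg h

lemma raagD_joinChain {v : Fin n} {a b : Finset (Fin n) → MonoidAlgebra k (RAAG Γ)}
    (ha : ∀ J, a J ≠ 0 → ∀ j ∈ J, v < j) (hb : ∀ J, b J ≠ 0 → v ∉ J) :
    raagD Γ k (joinChain v a b) =
      joinChain v (-raagD Γ k a) ((fun J => a J * raagU Γ k v) + raagD Γ k b) := by
  funext J
  by_cases hv : v ∈ J
  · rw [joinChain_of_mem hv, Pi.neg_apply]
    rw [raagD_apply, raagD_apply, ← Finset.sum_neg_distrib]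
    refine Finset.sum_congr rfl fun i _ => ?_
    by_cases hi : i ∈ J
    · rw [if_pos hi]
      by_cases hiv : i = v
      · subst hiv
        have : a (insert i (J.erase i)) = 0 := by
          by_contra h
          exact lt_irrefl _ (ha _ h i (by simp))
        simp [this]
      · rw [if_pos (Finset.mem_erase.2 ⟨hiv, hi⟩), neg_zero]
    · have hiv : i ≠ v := by rintro rfl; exact hi hv
      rw [if_neg hi, if_neg (fun h => hi (Finset.mem_of_mem_erase h)),
        joinChain_of_mem (Finset.mem_insert_of_mem hv), Finset.erase_insert_of_ne hiv]
      by_cases hz : a (insert i (J.erase v)) = 0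
      · simp [hz]
      · have hlt : v < i := ha _ hz i (by simp)
        have : (J.filter (· < i)).card = ((J.erase v).filter (· < i)).card + 1 := by
          conv_lhs => rw [← Finset.insert_erase hv]
          rw [Finset.filter_insert, if_pos hlt, Finset.card_insert_of_notMem]
          simp
        rw [this, pow_succ, mul_neg_one, neg_smul]
  · rw [joinChain_of_notMem hv, Pi.add_apply]
    rw [raagD_apply, raagD_apply]
    have : a J * raagU Γ k v = ∑ i, if i = v then a J * raagU Γ k v else 0 := by simp
    rw [this, ← Finset.sum_add_distrib]
    refine Finset.sum_congr rfl fun i _ => ?_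
    by_cases hiv : i = v
    · subst hiv
      have hb0 : b (insert i J) = 0 := by
        by_contra h
        exact hb _ h (by simp)
      rw [if_neg hv, if_pos rfl, if_neg hv, joinChain_of_mem (Finset.mem_insert_self _ _),
        Finset.erase_insert hv, hb0, zero_mul, smul_zero, add_zero]
      by_cases hz : a J = 0
      · simp [hz]
      · rw [Finset.filter_false_of_mem (fun j hj => (ha _ hz j hj).not_gt)]
        simp
    · rw [if_neg hiv, zero_add, joinChain_of_notMem (by simp [hv, Ne.symm hiv])]

/-- A cycle whose coefficient at the empty face lies in the augmentation left ideal of `S` is a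
boundary as soon as this holds for cycles with zero coefficient there. -/
lemma exists_raagD_eq_of_mem {S : Finset (Fin n)}
    (hS : ∀ x : Finset (Fin n) → MonoidAlgebra k (RAAG Γ), FaceSupported S x →
      raagD Γ k x = 0 → x ∅ = 0 → ∃ y, FaceSupported S y ∧ raagD Γ k y = x ∧ y ∅ = 0)
    {x : Finset (Fin n) → MonoidAlgebra k (RAAG Γ)} (hx : FaceSupported S x)
    (hDx : raagD Γ k x = 0) (hx0 : x ∅ ∈ raagIdeal Γ k S) :
    ∃ y, FaceSupported S y ∧ raagD Γ k y = x ∧ y ∅ = 0 := by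
  obtain ⟨c, hc, hcx⟩ := mem_raagIdeal_iff.1 hx0
  let z : Finset (Fin n) → MonoidAlgebra k (RAAG Γ) := fun J => ∑ i, if J = {i} then c i else 0
  have hzi : ∀ i, z {i} = c i := fun i => by simp [z]
  have hz : FaceSupported S z := by
    intro J hJ
    obtain ⟨i, -, hi⟩ := Finset.exists_ne_zero_of_sum_ne_zero hJ
    have hJi : J = {i} := by
      by_contra h
      exact hi (if_neg h)
    subst hJi
    rw [if_pos rfl] at hi
    refine ⟨?_, ?_⟩
    · intro a ha b hb hab
      simp only [Finset.mem_singleton] at ha hb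
      exact absurd (ha.trans hb.symm) hab
    · rw [Finset.singleton_subset_iff]
      by_contra h
      exact hi (hc i h)
  have hDz0 : raagD Γ k z ∅ = x ∅ := by
    rw [raagD_apply_empty, ← hcx]
    simp [hzi]
  have hDz : ∀ J, J ≠ ∅ → raagD Γ k z J = 0 := by
    intro J hJ
    rw [raagD_apply]
    refine Finset.sum_eq_zero fun i _ => ?_
    split_ifs with hi
    · rfl
    · have : z (insert i J) = 0 := by
        refine Finset.sum_eq_zero fun l _ => if_neg fun h => hJ ?_
        have hil : i = l := Finset.mem_singleton.1 (h ▸ Finset.mem_insert_self i J)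
        subst hil
        refine Finset.eq_empty_of_forall_notMem fun j hj => hi ?_
        have : j = i := Finset.mem_singleton.1 (h ▸ Finset.mem_insert_of_mem hj)
        exact this ▸ hj
      simp [this]
  obtain ⟨y, hy, hDy, hy0⟩ := hS (x + -raagD Γ k z)
    (hx.add fun J hJ => hz.raagD J (by simpa using hJ))
    (by rw [map_add, map_neg, raagD_raagD hz, hDx, neg_zero, add_zero])
    (by rw [Pi.add_apply, Pi.neg_apply, hDz0, add_neg_cancel])
  refine ⟨y + z, hy.add hz, ?_, ?_⟩
  · rw [map_add, hDy, neg_add_cancel_right]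
  · rw [Pi.add_apply, hy0, zero_add]
    exact Finset.sum_eq_zero fun i _ => if_neg (Finset.singleton_ne_empty i).symm

lemma exists_raagD_eq (S : Finset (Fin n)) :
    ∀ x : Finset (Fin n) → MonoidAlgebra k (RAAG Γ), FaceSupported S x →
      raagD Γ k x = 0 → x ∅ = 0 → ∃ y, FaceSupported S y ∧ raagD Γ k y = x ∧ y ∅ = 0 := by
  induction S using Finset.strongInduction with | H S ih => ?_
  intro x hx hDx hx0
  rcases S.eq_empty_or_nonempty with rfl | hne
  · refine ⟨0, fun J hJ => absurd rfl hJ, ?_, rfl⟩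
    rw [map_zero]
    funext J
    by_contra h
    have := (hx J (Ne.symm h)).2
    rw [Finset.subset_empty] at this
    subst this
    exact h hx0.symm
  set v := S.min' hne with hv
  have hvS : v ∈ S := S.min'_mem hne
  set S' := S.erase v with hS'
  set L := S'.filter (Γ.Adj v) with hL
  have hvS' : v ∉ S' := Finset.notMem_erase v S
  have hltS' : ∀ j ∈ S', v < j := fun j hj =>
    lt_of_le_of_ne (S.min'_le j (Finset.mem_of_mem_erase hj)) (Finset.ne_of_mem_erase hj).symm
  have hLS' : L ⊆ S' := Finset.filter_subset _ _
  have hS'S : S' ⊂ S := Finset.erase_ssubset hvS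
  let a : Finset (Fin n) → MonoidAlgebra k (RAAG Γ) := fun J =>
    if v ∈ J then 0 else x (insert v J)
  let b : Finset (Fin n) → MonoidAlgebra k (RAAG Γ) := fun J => if v ∈ J then 0 else x J
  have hxab : x = joinChain v a b := by
    funext J
    by_cases h : v ∈ J
    · simp [joinChain, a, h, Finset.insert_erase h]
    · simp [joinChain, b, h]
  have haL : FaceSupported L a := by
    intro J hJ
    have hvJ : v ∉ J := fun h => hJ (if_pos h)
    have hxJ : x (insert v J) ≠ 0 := fun h => hJ (by simp [a, h])
    have h1 := hx _ hxJ
    refine ⟨cliqueComplex_mono (Finset.subset_insert _ _) h1.1, fun j hj => ?_⟩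
    have hvj : v ≠ j := by rintro h; exact hvJ (h ▸ hj)
    exact Finset.mem_filter.2 ⟨Finset.mem_erase.2 ⟨hvj.symm, h1.2 (Finset.mem_insert_of_mem hj)⟩,
      h1.1 v (Finset.mem_insert_self _ _) j (Finset.mem_insert_of_mem hj) hvj⟩
  have hbS' : FaceSupported S' b := by
    intro J hJ
    have hvJ : v ∉ J := fun h => hJ (if_pos h)
    have hxJ : x J ≠ 0 := fun h => hJ (by simp [b, h])
    exact ⟨(hx _ hxJ).1, fun j hj => Finset.mem_erase.2
      ⟨fun h => hvJ (h ▸ hj), (hx _ hxJ).2 hj⟩⟩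
  have ltL : ∀ {z : Finset (Fin n) → MonoidAlgebra k (RAAG Γ)}, FaceSupported L z →
      ∀ J, z J ≠ 0 → ∀ j ∈ J, v < j := fun hz J hJ j hj => hltS' j (hLS' ((hz J hJ).2 hj))
  have notS' : ∀ {z : Finset (Fin n) → MonoidAlgebra k (RAAG Γ)}, FaceSupported S' z →
      ∀ J, z J ≠ 0 → v ∉ J := fun hz J hJ hj => hvS' ((hz J hJ).2 hj)
  have hmul : ∀ {z : Finset (Fin n) → MonoidAlgebra k (RAAG Γ)}, FaceSupported L z →
      FaceSupported S' (fun J => z J * raagU Γ k v) := by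
    intro z hz J hJ
    have : z J ≠ 0 := fun h => hJ (by simp [h])
    exact ⟨(hz J this).1, (hz J this).2.trans hLS'⟩
  rw [hxab, raagD_joinChain (ltL haL) (notS' hbS')] at hDx
  have hDa : raagD Γ k a = 0 := by
    funext J
    by_contra h
    have hvJ : v ∉ J := fun h' => lt_irrefl _ (ltL haL.raagD J h v h')
    have := congrFun hDx (insert v J)
    rw [joinChain_of_mem (Finset.mem_insert_self v J), Finset.erase_insert hvJ, Pi.neg_apply,
      Pi.zero_apply, neg_eq_zero] at this
    exact h this
  have hDb : (fun J => a J * raagU Γ k v) + raagD Γ k b = 0 := by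
    funext J
    by_contra h
    have hvJ : v ∉ J := notS' ((hmul haL).add hbS'.raagD) J h
    have := congrFun hDx J
    rw [joinChain_of_notMem hvJ] at this
    exact h this
  have ha0 : a ∅ ∈ raagIdeal Γ k L := by
    refine mem_raagIdeal_link hvS' (mem_raagIdeal_iff.2 ⟨fun i => -b {i}, fun i hi => ?_, ?_⟩)
    · by_contra h
      exact hi ((hbS' _ (fun h' => h (by simp [h']))).2 (Finset.mem_singleton_self i))
    · have := congrFun hDb ∅
      rw [Pi.add_apply, Pi.zero_apply, raagD_apply_empty] at this
      rw [eq_neg_of_add_eq_zero_left this, ← Finset.sum_neg_distrib]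
      exact Finset.sum_congr rfl fun i _ => neg_mul _ _
  obtain ⟨a', ha'L, hDa', ha'0⟩ :=
    exists_raagD_eq_of_mem (ih L (hLS'.trans_ssubset hS'S)) haL hDa ha0
  have hDmul : raagD Γ k (fun J => a' J * raagU Γ k v) = fun J => a J * raagU Γ k v := by
    funext J
    rw [← hDa', raagD_apply, raagD_apply, Finset.sum_mul]
    refine Finset.sum_congr rfl fun i _ => ?_
    split_ifs
    · simp
    · by_cases hz : a' (insert i J) = 0
      · simp [hz]
      · have hadj : Γ.Adj v i :=
          (Finset.mem_filter.1 ((ha'L _ hz).2 (Finset.mem_insert_self i J))).2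
        rw [mul_assoc, raagU_comm hadj, smul_mul_assoc, mul_assoc]
  obtain ⟨b', hb'S', hDb', hb'0⟩ := ih S' hS'S (b + fun J => a' J * raagU Γ k v)
    (hbS'.add (hmul ha'L)) (by rw [map_add, hDmul, add_comm, hDb])
    (by simp [b, hx0, ha'0])
  have hna' : FaceSupported L (-a') := fun J hJ => ha'L J (by simpa using hJ)
  refine ⟨joinChain v (-a') b', ?_, ?_, ?_⟩
  · intro J hJ
    by_cases hvJ : v ∈ J
    · rw [joinChain_of_mem hvJ] at hJ
      obtain ⟨h1, h2⟩ := hna' _ hJ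
      have hadj : ∀ i ∈ J, i ≠ v → Γ.Adj v i := fun i hi hiv =>
        (Finset.mem_filter.1 (h2 (Finset.mem_erase.2 ⟨hiv, hi⟩))).2
      refine ⟨fun i hi j hj hij => ?_, fun j hj => ?_⟩
      · by_cases hiv : i = v
        · subst hiv
          exact hadj j hj hij.symm
        · by_cases hjv : j = v
          · subst hjv
            exact (hadj i hi hij).symm
          · exact h1 i (Finset.mem_erase.2 ⟨hiv, hi⟩) j (Finset.mem_erase.2 ⟨hjv, hj⟩) hij
      · by_cases hjv : j = v
        · exact hjv ▸ hvS
        · exact hS'S.1 (hLS' (h2 (Finset.mem_erase.2 ⟨hjv, hj⟩)))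
    · rw [joinChain_of_notMem hvJ] at hJ
      exact ⟨(hb'S' J hJ).1, (hb'S' J hJ).2.trans hS'S.1⟩
  · rw [raagD_joinChain (ltL hna') (notS' hb'S'), hxab, map_neg, neg_neg, hDa', hDb']
    congr 1
    funext J
    simp
  · simp [joinChain, hb'0]

/-- The augmentation of the group algebra. -/
def raagAug (Γ : SimpleGraph (Fin n)) (k : Type) [CommRing k] :
    MonoidAlgebra k (RAAG Γ) →ₗ[k] k :=
  Finsupp.linearCombination k (fun _ => (1 : k)) ∘ₗ (coeffLinearEquiv k).toLinearMap

lemma raagAug_single (g : RAAG Γ) (r : k) : raagAug Γ k (single g r) = r := by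
  simp [raagAug]

/-- The augmentation ideal is spanned by the elements `vᵢ - 1`. -/
lemma mem_raagIdeal_univ {a : MonoidAlgebra k (RAAG Γ)} (ha : raagAug Γ k a = 0) :
    a ∈ raagIdeal Γ k Finset.univ := by
  let q := Submodule.Quotient.mk (p := raagIdeal Γ k Finset.univ)
  have hgen : ∀ (g : RAAG Γ) i, q (single (g * raagGen Γ i) 1) = q (single g 1) := by
    intro g i
    refine (Submodule.Quotient.eq _).2 ?_
    have : (single (g * raagGen Γ i) 1 - single g 1 : MonoidAlgebra k (RAAG Γ)) =
        single g 1 * raagU Γ k i := by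
      rw [raagU, mul_sub, single_mul_single, mul_one, mul_one]
    rw [this]
    exact Ideal.mul_mem_left _ _ (Ideal.subset_span ⟨i, Finset.mem_coe.2 (Finset.mem_univ i), rfl⟩)
  have hall : ∀ g h : RAAG Γ, q (single (h * g) 1) = q (single h 1) := by
    intro g
    induction g using PresentedGroup.induction_on with | _ w => ?_
    induction w using FreeGroup.induction_on with
    | C1 => simp
    | of i => exact fun h => hgen h i
    | inv_of i _ =>
      intro h
      rw [map_inv, ← hgen _ i]
      change q (single (h * (raagGen Γ i)⁻¹ * raagGen Γ i) 1) = _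
      rw [inv_mul_cancel_right]
    | mul x y hx hy =>
      intro h
      rw [map_mul, ← mul_assoc, hy, hx]
  have key : ∀ a : MonoidAlgebra k (RAAG Γ), q a = q (single 1 (raagAug Γ k a)) := by
    intro a
    induction a using MonoidAlgebra.induction_linear with
    | zero => simp
    | add f g hf hg =>
      rw [map_add, single_add]
      change q f + q g = q _ + q _
      rw [hf, hg]
    | single g r =>
      rw [raagAug_single, ← mul_one r, ← smul_single', ← smul_single']
      change r • q _ = r • q _
      rw [← hall g 1, one_mul]
  refine (Submodule.Quotient.mk_eq_zero _).1 ((key a).trans ?_)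
  rw [ha, single_zero]
  rfl

end Acyclicity

/-! ### The resolution of the trivial representation indexed by faces -/

section Resolution

open CategoryTheory MonoidAlgebra

variable {n : ℕ} (Γ : SimpleGraph (Fin n)) (k : Type) [CommRing k]

/-- The cliques of cardinality `p`. -/
abbrev FaceIndex (p : ℕ) : Type := {I : Finset (Fin n) // I ∈ cliqueComplex Γ ∧ I.card = p}

variable {Γ} in
/-- The face `J \ i` of a face `J`. -/
def FaceIndex.erase {p : ℕ} (J : FaceIndex Γ (p + 1)) (i : Fin n)
    (h : i ∈ J.1 ∧ J.1.erase i ∈ cliqueComplex Γ) : FaceIndex Γ p :=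
  ⟨J.1.erase i, h.2, by rw [Finset.card_erase_of_mem h.1, J.2.2, Nat.add_sub_cancel]⟩

/-- The boundary of a basis element of the resolution. -/
def raagBoundary (p : ℕ) (J : FaceIndex Γ (p + 1)) :
    FaceIndex Γ p →₀ MonoidAlgebra k (RAAG Γ) :=
  ∑ i : Fin n, if h : i ∈ J.1 ∧ J.1.erase i ∈ cliqueComplex Γ then
    ((-1 : ℤ) ^ (J.1.filter (· < i)).card) • Finsupp.single (J.erase i h) (raagU Γ k i) else 0

/-- The differential of the resolution. -/
def raagRepD (p : ℕ) :
    Rep.free k (RAAG Γ) (FaceIndex Γ (p + 1)) ⟶ Rep.free k (RAAG Γ) (FaceIndex Γ p) :=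
  Rep.freeLift k (RAAG Γ) _ (raagBoundary Γ k p)

/-- Extension by zero of chains to all finite sets of vertices. -/
def chainExtend (p : ℕ) : (FaceIndex Γ p →₀ MonoidAlgebra k (RAAG Γ)) →ₗ[k]
    (Finset (Fin n) → MonoidAlgebra k (RAAG Γ)) :=
  LinearMap.pi fun J => if h : J ∈ cliqueComplex Γ ∧ J.card = p then
    Finsupp.lapply ⟨J, h⟩ else 0

variable {Γ k}

lemma chainExtend_apply {p : ℕ} (x : FaceIndex Γ p →₀ MonoidAlgebra k (RAAG Γ))
    (J : FaceIndex Γ p) : chainExtend Γ k p x J.1 = x J := by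
  simp only [chainExtend, LinearMap.pi_apply]
  rw [dif_pos J.2]
  rfl

lemma chainExtend_of_not {p : ℕ} (x : FaceIndex Γ p →₀ MonoidAlgebra k (RAAG Γ))
    {J : Finset (Fin n)} (h : ¬ (J ∈ cliqueComplex Γ ∧ J.card = p)) :
    chainExtend Γ k p x J = 0 := by
  simp only [chainExtend, LinearMap.pi_apply]
  rw [dif_neg h]
  rfl

lemma chainExtend_single {p : ℕ} (I : FaceIndex Γ p) (a : MonoidAlgebra k (RAAG Γ))
    (J : Finset (Fin n)) :
    chainExtend Γ k p (Finsupp.single I a) J = if J = I.1 then a else 0 := by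
  by_cases h : J ∈ cliqueComplex Γ ∧ J.card = p
  · refine (chainExtend_apply _ ⟨J, h⟩).trans ?_
    rw [Finsupp.single_apply]
    refine if_congr ?_ rfl rfl
    rw [Subtype.ext_iff]
    exact eq_comm
  · rw [chainExtend_of_not _ h, if_neg]
    rintro rfl
    exact h I.2

lemma chainExtend_injective (p : ℕ) : Function.Injective (chainExtend Γ k p) := by
  intro x y h
  ext1 J
  rw [← chainExtend_apply, h, chainExtend_apply]

lemma chainExtend_faceSupported {p : ℕ} (x : FaceIndex Γ p →₀ MonoidAlgebra k (RAAG Γ)) :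
    FaceSupported Finset.univ (chainExtend Γ k p x) := by
  intro J hJ
  refine ⟨?_, Finset.subset_univ _⟩
  by_contra h
  exact hJ (chainExtend_of_not x fun h' => h h'.1)

lemma raagRepD_single {p : ℕ} (J : FaceIndex Γ (p + 1)) (g : RAAG Γ) (r : k) :
    (raagRepD Γ k p).hom (Finsupp.single J (single g r)) =
      ∑ i : Fin n, if h : i ∈ J.1 ∧ J.1.erase i ∈ cliqueComplex Γ then
        ((-1 : ℤ) ^ (J.1.filter (· < i)).card) •
          Finsupp.single (J.erase i h) (single g r * raagU Γ k i) else 0 := by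
  have h1 : (raagRepD Γ k p).hom (Finsupp.single J (single g r)) =
      r • Representation.free k (RAAG Γ) (FaceIndex Γ p) g (raagBoundary Γ k p J) := by
    simp [raagRepD]
  rw [h1, raagBoundary, map_sum, Finset.smul_sum]
  refine Finset.sum_congr rfl fun i _ => ?_
  split_ifs with h
  · rw [map_zsmul, smul_comm]
    congr 1
    rw [Representation.finsupp_single, Finsupp.smul_single]
    congr 1
    rw [raagU, map_sub, MonoidAlgebra.one_def]
    erw [Representation.ofMulAction_single, Representation.ofMulAction_single]
    rw [mul_sub, single_mul_single, single_mul_single, smul_sub]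
    simp
  · simp

lemma chainExtend_raagRepD {p : ℕ}
    (x : FaceIndex Γ (p + 1) →₀ MonoidAlgebra k (RAAG Γ)) :
    chainExtend Γ k p ((raagRepD Γ k p).hom x) = raagD Γ k (chainExtend Γ k (p + 1) x) := by
  induction x using Finsupp.induction_linear with
  | zero => simp
  | add x y hx hy => rw [map_add, map_add, map_add, map_add, hx, hy]
  | single J a =>
    induction a using MonoidAlgebra.induction_linear with
    | zero => simp
    | add a b ha hb =>
      rw [Finsupp.single_add, map_add, map_add, map_add, map_add, ha, hb]
    | single g r =>
      rw [raagRepD_single, map_sum]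
      funext I
      rw [Finset.sum_apply, raagD_apply]
      refine Finset.sum_congr rfl fun i _ => ?_
      rw [chainExtend_single]
      by_cases hi : i ∈ I
      · rw [if_pos hi]
        split_ifs with h
        · rw [map_zsmul, Pi.smul_apply, chainExtend_single, if_neg, smul_zero]
          rintro rfl
          simp [FaceIndex.erase] at hi
        · simp
      · rw [if_neg hi]
        by_cases hIJ : insert i I = J.1
        · have hiJ : i ∈ J.1 := hIJ ▸ Finset.mem_insert_self i I
          have hJi : J.1.erase i = I := by rw [← hIJ, Finset.erase_insert hi]
          have h : i ∈ J.1 ∧ J.1.erase i ∈ cliqueComplex Γ :=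
            ⟨hiJ, cliqueComplex_mono (Finset.erase_subset _ _) J.2.1⟩
          rw [dif_pos h, if_pos hIJ, map_zsmul, Pi.smul_apply, chainExtend_single,
            if_pos (show I = (J.erase i h).1 from hJi.symm), ← hIJ,
            Finset.filter_insert, if_neg (lt_irrefl i)]
        · rw [if_neg hIJ, zero_mul, smul_zero]
          split_ifs with h
          · rw [map_zsmul, Pi.smul_apply, chainExtend_single, if_neg, smul_zero]
            rintro rfl
            exact hIJ (Finset.insert_erase h.1)
          · simp

variable (Γ k)

lemma raagRepD_comp (p : ℕ) : raagRepD Γ k (p + 1) ≫ raagRepD Γ k p = 0 := by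
  refine Rep.free_ext _ _ _ _ _ fun J => chainExtend_injective p ?_
  rw [Rep.hom_comp, Representation.IntertwiningMap.comp_apply, chainExtend_raagRepD,
    chainExtend_raagRepD, raagD_raagD (chainExtend_faceSupported _)]
  exact (map_zero _).symm

/-- The augmentation of the resolution. -/
def raagRepAug : Rep.free k (RAAG Γ) (FaceIndex Γ 0) ⟶ Rep.trivial k (RAAG Γ) k :=
  Rep.freeLift k (RAAG Γ) _ fun _ => (1 : k)

/-- The empty face. -/
def emptyFace : FaceIndex Γ 0 := ⟨∅, fun i hi => absurd hi (Finset.notMem_empty i), rfl⟩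

variable {Γ k}

lemma faceIndex_zero_eq (J : FaceIndex Γ 0) : J = emptyFace Γ :=
  Subtype.ext (Finset.card_eq_zero.1 J.2.2)

lemma raagRepAug_apply (x : FaceIndex Γ 0 →₀ MonoidAlgebra k (RAAG Γ)) :
    (raagRepAug Γ k).hom x = raagAug Γ k (x (emptyFace Γ)) := by
  induction x using Finsupp.induction_linear with
  | zero => simp
  | add x y hx hy => rw [map_add, Finsupp.add_apply, map_add, hx, hy]
  | single J a =>
    rw [faceIndex_zero_eq J]
    induction a using MonoidAlgebra.induction_linear with
    | zero => simp
    | add a b ha hb =>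
      rw [Finsupp.single_add, map_add, ha, hb, Finsupp.add_apply, map_add]
    | single g r =>
      rw [Finsupp.single_eq_same, raagAug_single]
      simp [raagRepAug]

/-- Restriction of a chain on all finite sets to the faces of cardinality `p`. -/
def chainRestrict (p : ℕ) (x : Finset (Fin n) → MonoidAlgebra k (RAAG Γ)) :
    FaceIndex Γ p →₀ MonoidAlgebra k (RAAG Γ) :=
  Finsupp.equivFunOnFinite.symm fun J => x J.1

lemma raagRepD_chainRestrict {p : ℕ} {x : FaceIndex Γ p →₀ MonoidAlgebra k (RAAG Γ)}
    {y : Finset (Fin n) → MonoidAlgebra k (RAAG Γ)} (hy : FaceSupported Finset.univ y)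
    (h : raagD Γ k y = chainExtend Γ k p x) :
    (raagRepD Γ k p).hom (chainRestrict (p + 1) y) = x := by
  refine Finsupp.ext fun J => ?_
  rw [← chainExtend_apply, chainExtend_raagRepD, ← chainExtend_apply x, ← h, raagD_apply,
    raagD_apply]
  refine Finset.sum_congr rfl fun i _ => ?_
  split_ifs with hi
  · rfl
  · congr 2
    have hcard : (insert i J.1).card = p + 1 := by rw [Finset.card_insert_of_notMem hi, J.2.2]
    by_cases hK : insert i J.1 ∈ cliqueComplex Γ
    · exact chainExtend_apply (chainRestrict (p + 1) y) ⟨_, hK, hcard⟩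
    · rw [chainExtend_of_not _ fun h' => hK h'.1]
      by_contra hne
      exact hK (hy _ (Ne.symm hne)).1

lemma raagRepD_exact {p : ℕ} (x : FaceIndex Γ (p + 1) →₀ MonoidAlgebra k (RAAG Γ))
    (hx : (raagRepD Γ k p).hom x = 0) : ∃ y, (raagRepD Γ k (p + 1)).hom y = x := by
  obtain ⟨y, hy, hDy, -⟩ := exists_raagD_eq Finset.univ (chainExtend Γ k (p + 1) x)
    (chainExtend_faceSupported x) (by rw [← chainExtend_raagRepD, hx]; exact map_zero _)
    (chainExtend_of_not x (by simp))
  exact ⟨_, raagRepD_chainRestrict hy hDy⟩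

lemma raagRepAug_exact (x : FaceIndex Γ 0 →₀ MonoidAlgebra k (RAAG Γ))
    (hx : (raagRepAug Γ k).hom x = 0) : ∃ y, (raagRepD Γ k 0).hom y = x := by
  rw [raagRepAug_apply] at hx
  obtain ⟨y, hy, hDy, -⟩ := exists_raagD_eq_of_mem (exists_raagD_eq Finset.univ)
    (chainExtend_faceSupported x)
    (by
      funext J
      rw [raagD_apply]
      refine Finset.sum_eq_zero fun i _ => ?_
      rw [chainExtend_of_not x, zero_mul, smul_zero, ite_self]
      rintro ⟨-, h⟩
      exact Finset.insert_ne_empty _ _ (Finset.card_eq_zero.1 h))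
    (mem_raagIdeal_univ (by rw [← hx]; exact congrArg _ (chainExtend_apply x (emptyFace Γ))))
  exact ⟨_, raagRepD_chainRestrict hy hDy⟩

lemma raagRepD_comp_raagRepAug : raagRepD Γ k 0 ≫ raagRepAug Γ k = 0 := by
  refine Rep.free_ext _ _ _ _ _ fun J => ?_
  rw [Rep.hom_comp, Representation.IntertwiningMap.comp_apply, raagRepAug_apply,
    ← chainExtend_apply, chainExtend_raagRepD]
  change raagAug Γ k (raagD Γ k _ ∅) = _
  rw [raagD_apply_empty, map_sum]
  refine Finset.sum_eq_zero fun i _ => ?_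
  rw [chainExtend_single]
  split_ifs
  · rw [raagU, ← MonoidAlgebra.one_def, one_mul, map_sub, raagAug_single, MonoidAlgebra.one_def,
      raagAug_single, sub_self]
  · rw [zero_mul, map_zero]

end Resolution

section ProjectiveResolution

open CategoryTheory

variable {n : ℕ} (Γ : SimpleGraph (Fin n)) (k : Type) [CommRing k]

lemma Rep.exact_of_forall {k G : Type} [CommRing k] [Group G] (S : ShortComplex (Rep k G))
    (h : ∀ x : S.X₂, S.g.hom x = 0 → ∃ y : S.X₁, S.f.hom y = x) : S.Exact := by
  rw [← ShortComplex.exact_map_iff_of_faithful S (forget₂ (Rep k G) (ModuleCat k)),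
    ShortComplex.moduleCat_exact_iff]
  exact h

/-- The chain complex of free representations indexed by the cliques of `Γ`. -/
def raagComplex : ChainComplex (Rep k (RAAG Γ)) ℕ :=
  ChainComplex.of (fun p => Rep.free k (RAAG Γ) (FaceIndex Γ p)) (raagRepD Γ k) (raagRepD_comp Γ k)

lemma raagComplex_d (p : ℕ) : (raagComplex Γ k).d (p + 1) p = raagRepD Γ k p := by
  simp [raagComplex]

lemma raagComplex_exactAt_succ (p : ℕ) : (raagComplex Γ k).ExactAt (p + 1) := by
  rw [HomologicalComplex.exactAt_iff' _ (p + 1 + 1) (p + 1) p (by simp) (by simp)]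
  refine Rep.exact_of_forall _ ?_
  change ∀ x, ((raagComplex Γ k).d (p + 1) p).hom x = 0 →
    ∃ y, ((raagComplex Γ k).d (p + 1 + 1) (p + 1)).hom y = x
  rw [raagComplex_d, raagComplex_d]
  exact raagRepD_exact

instance : Epi (raagRepAug Γ k) := by
  refine (forget₂ (Rep k (RAAG Γ)) (ModuleCat k)).epi_of_epi_map ?_
  rw [ModuleCat.epi_iff_surjective]
  intro r
  refine ⟨(Finsupp.single (emptyFace Γ) (MonoidAlgebra.single 1 r) :
    FaceIndex Γ 0 →₀ MonoidAlgebra k (RAAG Γ)), ?_⟩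
  refine (raagRepAug_apply _).trans ?_
  rw [Finsupp.single_eq_same, raagAug_single]

/-- The projective resolution of the trivial representation of a right-angled Artin group
indexed by the cliques of the graph. -/
def raagResolution : ProjectiveResolution (Rep.trivial k (RAAG Γ) k) where
  complex := raagComplex Γ k
  projective p := inferInstanceAs (Projective (Rep.free k (RAAG Γ) (FaceIndex Γ p)))
  π := (ChainComplex.toSingle₀Equiv _ _).symm ⟨raagRepAug Γ k, by
    rw [raagComplex_d]
    exact raagRepD_comp_raagRepAug⟩
  quasiIso := ⟨fun p => by
    cases p with
    | zero =>
      rw [ChainComplex.quasiIsoAt₀_iff, ShortComplex.quasiIso_iff_of_zeros' _ rfl rfl rfl]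
      refine (ShortComplex.exact_and_epi_g_iff_of_iso (S₂ := ShortComplex.mk _ _
        (raagRepD_comp_raagRepAug (Γ := Γ) (k := k))) ?_).2
          ⟨Rep.exact_of_forall _ raagRepAug_exact, inferInstanceAs (Epi (raagRepAug Γ k))⟩
      refine ShortComplex.isoMk (Iso.refl _) (Iso.refl _) (Iso.refl _) ?_ ?_
      · refine (Category.id_comp _).trans (Eq.trans ?_ (Category.comp_id _).symm)
        exact (raagComplex_d Γ k 0).symm
      · refine (Category.id_comp _).trans (Eq.trans ?_ (Category.comp_id _).symm)
        exact (ChainComplex.toSingle₀Equiv_symm_apply_f_zero (C := raagComplex Γ k) _ _).symm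
    | succ p =>
      rw [quasiIsoAt_iff_exactAt']
      · exact raagComplex_exactAt_succ Γ k p
      · exact ChainComplex.exactAt_succ_single_obj _ _⟩

end ProjectiveResolution

/-! ### Homology of complexes of modules in coordinates -/

section ModuleHomology

open CategoryTheory

variable {k : Type} [CommRing k]

lemma nonempty_homology_equiv_map_mkQ (S : ShortComplex (ModuleCat.{0} k)) {V W : Type}
    [AddCommGroup V] [Module k V] [AddCommGroup W] [Module k W] (e : S.X₂ ≃ₗ[k] V)
    (D : V →ₗ[k] W) (R : Submodule k V) (hker : ∀ x, S.g.hom x = 0 ↔ D (e x) = 0)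
    (hrange : ∀ x, (∃ y, S.f.hom y = x) ↔ e x ∈ R) :
    Nonempty (S.homology ≃ₗ[k] ↥(Submodule.map R.mkQ (LinearMap.ker D))) := by
  let F : LinearMap.ker S.g.hom →ₗ[k] ↥(Submodule.map R.mkQ (LinearMap.ker D)) :=
    ((R.mkQ.comp e.toLinearMap).comp (LinearMap.ker S.g.hom).subtype).codRestrict _
      fun x => ⟨e x, (hker x).1 x.2, rfl⟩
  have hF : Function.Surjective F := by
    rintro ⟨_, v, hv, rfl⟩
    refine ⟨⟨e.symm v, (hker _).2 ?_⟩, Subtype.ext ?_⟩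
    · rw [e.apply_symm_apply]
      exact hv
    · exact congrArg R.mkQ (e.apply_symm_apply v)
  have hK : LinearMap.range S.moduleCatToCycles = LinearMap.ker F := by
    ext x
    rw [LinearMap.mem_ker, ← Subtype.coe_inj]
    change _ ↔ R.mkQ (e x) = 0
    rw [Submodule.mkQ_apply, Submodule.Quotient.mk_eq_zero, ← hrange, LinearMap.mem_range]
    exact exists_congr fun y => Subtype.ext_iff
  exact ⟨S.moduleCatHomologyIso.toLinearEquiv ≪≫ₗ Submodule.quotEquivOfEq _ _ hK ≪≫ₗ
    F.quotKerEquivOfSurjective hF⟩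

lemma nonempty_homology_equiv (C : CochainComplex (ModuleCat.{0} k) ℕ) {V : ℕ → Type}
    [∀ q, AddCommGroup (V q)] [∀ q, Module k (V q)] (e : ∀ q, C.X q ≃ₗ[k] V q)
    (D : ∀ q, V q →ₗ[k] V (q + 1)) (pre : ∀ q, V (q - 1) →ₗ[k] V q)
    (hD : ∀ q x, e (q + 1) ((C.d q (q + 1)).hom x) = D q (e q x))
    (hpre : pre 0 = 0) (hpre' : ∀ q, pre (q + 1) = D q) (q : ℕ) :
    Nonempty (C.homology q ≃ₗ[k]
      ↥(Submodule.map (LinearMap.range (pre q)).mkQ (LinearMap.ker (D q)))) := by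
  have hker : ∀ q x, (C.d q (q + 1)).hom x = 0 ↔ D q (e q x) = 0 := fun q x => by
    rw [← hD, LinearEquiv.map_eq_zero_iff]
  have key : ∀ i, (ComplexShape.up ℕ).prev q = i →
      (∀ x, (∃ y, (C.d i q).hom y = x) ↔ e q x ∈ LinearMap.range (pre q)) →
      Nonempty (C.homology q ≃ₗ[k]
        ↥(Submodule.map (LinearMap.range (pre q)).mkQ (LinearMap.ker (D q)))) := by
    intro i hi h
    obtain ⟨E⟩ := nonempty_homology_equiv_map_mkQ (C.sc' i q (q + 1)) (e q) (D q)
      (LinearMap.range (pre q)) (hker q) h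
    exact ⟨(C.homologyIsoSc' i q (q + 1) hi (by simp)).toLinearEquiv ≪≫ₗ E⟩
  cases q with
  | zero =>
    refine key 0 (by simp) fun x => ?_
    rw [hpre, LinearMap.range_zero, Submodule.mem_bot, LinearEquiv.map_eq_zero_iff,
      C.shape 0 0 (by simp)]
    exact ⟨fun ⟨_, h⟩ => h.symm, fun h => ⟨0, h.symm⟩⟩
  | succ q =>
    refine key q (by simp) fun x => ?_
    rw [hpre', LinearMap.mem_range]
    constructor
    · rintro ⟨y, rfl⟩
      exact ⟨e q y, (hD q y).symm⟩
    · rintro ⟨y, hy⟩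
      refine ⟨(e q).symm y, (e (q + 1)).injective ?_⟩
      rw [hD, LinearEquiv.apply_symm_apply, hy]

end ModuleHomology

/-! ### The two computations of the cohomology -/

section Comparison

open CategoryTheory

/-- The representation of `G` on the Laurent ring through `φ`. -/
def laurentRho {m : ℕ} {G : Type} [Group G] (φ : G →* Multiplicative (Fin m → ℤ)) :
    Representation (LaurentRing ℤ m) G (LaurentRing ℤ m) where
  toFun g := yMul ℤ m (Multiplicative.toAdd (φ g))
  map_one' := by
    ext1
    simp [yMul, ← AddMonoidAlgebra.one_def]
  map_mul' g h := by
    ext1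
    simp [yMul, AddMonoidAlgebra.single_mul_single]

/-- The Laurent ring as an object of the category of representations of `G`. -/
abbrev laurentRep {m : ℕ} {G : Type} [Group G] (φ : G →* Multiplicative (Fin m → ℤ)) :
    Rep (LaurentRing ℤ m) G :=
  Rep.of (laurentRho φ)

lemma laurentRho_apply {m : ℕ} {G : Type} [Group G] (φ : G →* Multiplicative (Fin m → ℤ))
    (g : G) (x : LaurentRing ℤ m) :
    laurentRho φ g x = AddMonoidAlgebra.single (Multiplicative.toAdd (φ g)) 1 * x :=
  rfl

lemma nonempty_groupCohomology_equiv {m : ℕ} {G : Type} [Group G]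
    (φ : G →* Multiplicative (Fin m → ℤ)) (q : ℕ) :
    Nonempty (groupCohomology (laurentRep φ) q ≃ₗ[LaurentRing ℤ m]
      groupCohomologyLaurent ℤ φ q) := by
  refine nonempty_homology_equiv (groupCohomology.inhomogeneousCochains (laurentRep φ))
    (V := inhomogCochains ℤ m G) (fun q => Iso.toLinearEquiv
      (Iso.refl (ModuleCat.of (LaurentRing ℤ m) ((Fin q → G) → LaurentRing ℤ m))))
    (inhomogCoD ℤ φ) (inhomogCoDpre ℤ φ) (fun q x => ?_) rfl (fun q => rfl) q
  rw [groupCohomology.inhomogeneousCochains.d_def]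
  funext g
  let y : (Fin q → G) → LaurentRing ℤ m := x
  change yMul ℤ m _ (y fun i => g i.succ) + ∑ j : Fin (q + 1),
    (-1 : LaurentRing ℤ m) ^ ((j : ℕ) + 1) • y (Fin.contractNth j (· * ·) g) =
      inhomogCoD ℤ φ q y g
  simp only [inhomogCoD, LinearMap.pi_apply, LinearMap.add_apply, LinearMap.comp_apply,
    LinearMap.proj_apply, LinearMap.sum_apply, LinearMap.smul_apply]
  congr 1
  refine Finset.sum_congr rfl fun j _ => ?_
  rw [zsmul_eq_mul, smul_eq_mul, Int.cast_pow, Int.cast_neg, Int.cast_one]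

variable {m n : ℕ} {Γ : SimpleGraph (Fin n)}

lemma hom_free_single {G α : Type} [Group G] (φ : G →* Multiplicative (Fin m → ℤ))
    (y : Rep.free (LaurentRing ℤ m) G α ⟶ laurentRep φ) (a : α) (g : G) :
    y.hom (Finsupp.single a (MonoidAlgebra.single g 1)) =
      laurentRho φ g (y.hom (Finsupp.single a (MonoidAlgebra.single 1 1))) := by
  refine Eq.trans ?_ (y.hom.isIntertwining _ _ g
    (Finsupp.single a (MonoidAlgebra.single 1 1)))
  congr 1
  simp

lemma nonempty_linearYoneda_homology_equiv (f : Fin n → Fin m)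
    (φ : RAAG Γ →* Multiplicative (Fin m → ℤ))
    (hφ : ∀ i : Fin n, φ (PresentedGroup.of i) = Multiplicative.ofAdd (Pi.single (f i) 1))
    (q : ℕ) :
    Nonempty (((raagResolution Γ (LaurentRing ℤ m)).complex.linearYonedaObj (LaurentRing ℤ m)
        (laurentRep φ)).homology q ≃ₗ[LaurentRing ℤ m]
      faceCohomology (cliqueComplex Γ) (LaurentRing ℤ m)
        (fun i => AddMonoidAlgebra.single (Pi.single (f i) 1) 1 - 1) q) := by
  let e : ∀ q, (Rep.free (LaurentRing ℤ m) (RAAG Γ) (FaceIndex Γ q) ⟶ laurentRep φ)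
      ≃ₗ[LaurentRing ℤ m] faceCochains (cliqueComplex Γ) (LaurentRing ℤ m) q :=
    fun q => Rep.freeLiftLEquiv (LaurentRing ℤ m) (RAAG Γ) (FaceIndex Γ q) (laurentRep φ)
  refine nonempty_homology_equiv _ (V := faceCochains (cliqueComplex Γ) (LaurentRing ℤ m))
    (fun q => (Iso.refl (ModuleCat.of (LaurentRing ℤ m)
      (Rep.free (LaurentRing ℤ m) (RAAG Γ) (FaceIndex Γ q) ⟶ laurentRep φ))).toLinearEquiv ≪≫ₗ e q)
    (faceCoD _ _ _) (faceCoDpre _ _ _) (fun q x => ?_) rfl (fun q => rfl) q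
  change e (q + 1) ((((raagResolution Γ (LaurentRing ℤ m)).complex.linearYonedaObj
    (LaurentRing ℤ m) (laurentRep φ)).d q (q + 1)).hom x) = faceCoD _ _ _ q (e q x)
  let y : Rep.free (LaurentRing ℤ m) (RAAG Γ) (FaceIndex Γ q) ⟶ laurentRep φ := x
  have h1 : (((raagResolution Γ (LaurentRing ℤ m)).complex.linearYonedaObj
      (LaurentRing ℤ m) (laurentRep φ)).d q (q + 1)).hom x = raagRepD Γ _ q ≫ y := by
    rw [← raagComplex_d]
    rfl
  rw [h1]
  funext J
  change y.hom ((raagRepD Γ _ q).hom (Finsupp.single J (MonoidAlgebra.single 1 1))) =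
    faceCoD _ _ _ q (e q y) J
  rw [raagRepD_single, map_sum]
  simp only [faceCoD, LinearMap.pi_apply, LinearMap.sum_apply]
  refine Finset.sum_congr rfl fun i _ => ?_
  split_ifs with h
  · rw [map_zsmul, LinearMap.smul_apply, LinearMap.comp_apply, LinearMap.proj_apply,
      LinearMap.mulLeft_apply, ← MonoidAlgebra.one_def, one_mul]
    congr 1
    rw [raagU, Finsupp.single_sub, map_sub, MonoidAlgebra.one_def, hom_free_single, hom_free_single,
      map_one,
      Module.End.one_apply, laurentRho_apply, raagGen, hφ, toAdd_ofAdd, sub_mul, one_mul]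
    rfl
  · rw [map_zero, LinearMap.zero_apply]

end Comparison

/-- Let `Γ` be a finite simple graph on `[n]` with clique
complex `K`, `f : [n] → [m]` surjective, and let `ℤ[ℤᵐ]` be the group ring,
a `G_Γ`-module with `vᵢ` acting by multiplication by `y_{f i}`.  Then for all
`q ≥ 0`, the group cohomology `H^q(G_Γ; ℤ[ℤᵐ])` is isomorphic (as a
`ℤ[ℤᵐ]`-module) to the `q`-th cohomology of the cochain complex of free
`ℤ[ℤᵐ]`-modules with basis the faces of `K` (in degree `= cardinality`) and
differential `δ ε_I = ∑_{i ∉ I, I ∪ {i} ∈ K} (-1)^{σ(I,i)} (y_{f i} - 1) ε_{I ∪ {i}}`. -/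
theorem groupCohomology_raag_iso_faceCohomology {n m : ℕ}
    (Γ : SimpleGraph (Fin n)) (f : Fin n → Fin m) (hf : Function.Surjective f)
    (φ : RAAG Γ →* Multiplicative (Fin m → ℤ))
    (hφ : ∀ i : Fin n, φ (PresentedGroup.of i) =
      Multiplicative.ofAdd (Pi.single (f i) 1))
    (q : ℕ) :
    Nonempty
      (groupCohomologyLaurent ℤ φ q ≃ₗ[LaurentRing ℤ m]
        faceCohomology (cliqueComplex Γ) (LaurentRing ℤ m)
          (fun i => AddMonoidAlgebra.single (Pi.single (f i) 1) 1 - 1) q) := by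
  obtain ⟨e₁⟩ := nonempty_groupCohomology_equiv φ q
  obtain ⟨e₂⟩ := nonempty_linearYoneda_homology_equiv f φ hφ q
  exact ⟨e₁.symm ≪≫ₗ (groupCohomologyIso (laurentRep φ) q
    (raagResolution Γ (LaurentRing ℤ m))).toLinearEquiv ≪≫ₗ e₂⟩
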